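/- (Transverse constancy step in the proof of Proposition 5.2) Let 𝒪 ⊆ ℝ⁴ be open and convex with V₊ ⊆ 𝒪, let p ∈ ℝ⁴ be positive lightlike, and let F : 𝒪 → ℂ be smooth with |F(x)| ≤ 1 for all x ∈ 𝒪, satisfying the directional-derivative equation Σ_ν pᵥ ∂_ν F(x) = 0 (derivative of F along the vector p vanishes) and the wave equation □F(x) = 0 for all x ∈ 𝒪. Then F(x) depends only on the Minkowski product p·x: for all x, y ∈ 𝒪 with p·x = p·y one has F(x) = F(y). -/

import Mathlib

noncomputable section

/-- Minkowski inner product on ℝ⁴: x·y = x₀y₀ − x₁y₁ − x₂y₂ − x₃y₃. -/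
def mink (x y : Fin 4 → ℝ) : ℝ := x 0 * y 0 - x 1 * y 1 - x 2 * y 2 - x 3 * y 3

/-- Partial derivative in the ν-th coordinate direction. -/
def pd {E : Type*} [NormedAddCommGroup E] [NormedSpace ℝ E]
    (ν : Fin 4) (f : (Fin 4 → ℝ) → E) (x : Fin 4 → ℝ) : E :=
  fderiv ℝ f x (Pi.single ν 1)

/-- The d'Alembertian □ = ∂₀² − ∂₁² − ∂₂² − ∂₃². -/
def box {E : Type*} [NormedAddCommGroup E] [NormedSpace ℝ E]
    (f : (Fin 4 → ℝ) → E) (x : Fin 4 → ℝ) : E :=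
  pd 0 (pd 0 f) x - pd 1 (pd 1 f) x - pd 2 (pd 2 f) x - pd 3 (pd 3 f) x

/-- The open forward light cone V₊ = {x : x₀ > 0, x·x > 0}. -/
def Vplus : Set (Fin 4 → ℝ) := {x | 0 < x 0 ∧ 0 < mink x x}

/-- A vector p is positive lightlike if p ≠ 0, p·p = 0 and p₀ > 0. -/
def PosLightlike (p : Fin 4 → ℝ) : Prop := p ≠ 0 ∧ mink p p = 0 ∧ 0 < p 0

open Set Filter Topology

/-- The orthogonal complement of a unit vector of ℝ³ has an orthonormal basis `u, v`; here this is
recorded by the orthogonality relations together with the resolution of the identity. -/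
lemma exists_transverse_frame {a b c : ℝ} (h : a ^ 2 + b ^ 2 + c ^ 2 = 1) :
    ∃ u₁ u₂ u₃ v₁ v₂ v₃ : ℝ,
      (u₁ ^ 2 + u₂ ^ 2 + u₃ ^ 2 = 1 ∧ v₁ ^ 2 + v₂ ^ 2 + v₃ ^ 2 = 1 ∧
        u₁ * v₁ + u₂ * v₂ + u₃ * v₃ = 0) ∧
      (a * u₁ + b * u₂ + c * u₃ = 0 ∧ a * v₁ + b * v₂ + c * v₃ = 0) ∧
      (u₁ * u₁ + v₁ * v₁ = 1 - a * a ∧ u₂ * u₂ + v₂ * v₂ = 1 - b * b ∧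
        u₃ * u₃ + v₃ * v₃ = 1 - c * c) ∧
      u₁ * u₂ + v₁ * v₂ = -(a * b) ∧ u₁ * u₃ + v₁ * v₃ = -(a * c) ∧
        u₂ * u₃ + v₂ * v₃ = -(b * c) := by
  by_cases hc : 1 + c = 0
  · obtain rfl : c = -1 := by linarith
    have ha : a = 0 := by nlinarith [sq_nonneg a, sq_nonneg b]
    have hb : b = 0 := by nlinarith [sq_nonneg a, sq_nonneg b]
    subst ha hb
    exact ⟨1, 0, 0, 0, 1, 0, by norm_num⟩
  · obtain ⟨k, hk⟩ : ∃ k, k * (1 + c) = 1 := ⟨(1 + c)⁻¹, inv_mul_cancel₀ hc⟩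
    have hab : k * (a ^ 2 + b ^ 2) = 1 - c := by
      linear_combination k * h + (1 - c) * hk
    have hkc : k * c = 1 - k := by linear_combination hk
    refine ⟨1 - k * a ^ 2, -(k * a * b), -a, -(k * a * b), 1 - k * b ^ 2, -b,
      ⟨?_, ?_, ?_⟩, ⟨?_, ?_⟩, ⟨?_, ?_, ?_⟩, ?_, ?_, ?_⟩
    · linear_combination k * a ^ 2 * hab - a ^ 2 * hkc
    · linear_combination k * b ^ 2 * hab - b ^ 2 * hkc
    · linear_combination k * a * b * hab - a * b * hkc
    · linear_combination -a * hab
    · linear_combination -b * hab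
    · linear_combination k * a ^ 2 * hab - a ^ 2 * hkc
    · linear_combination k * b ^ 2 * hab - b ^ 2 * hkc
    · linear_combination h
    · linear_combination k * a * b * hab - a * b * hkc
    · linear_combination a * hab
    · linear_combination b * hab

/-- An open convex set containing the open forward cone is stable under adding forward timelike
vectors. -/
lemma Convex.add_mem_of_mem_Vplus {O : Set (Fin 4 → ℝ)} (hconv : Convex ℝ O)
    (hV : Vplus ⊆ O) {x w : Fin 4 → ℝ} (hx : x ∈ O) (hw : w ∈ Vplus) : x + w ∈ O := by
  have hopen : IsOpen Vplus := by
    have h₁ : IsOpen {x : Fin 4 → ℝ | 0 < x 0} := isOpen_lt (by fun_prop) (by fun_prop)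
    have h₂ : IsOpen {x : Fin 4 → ℝ | 0 < mink x x} :=
      isOpen_lt (by fun_prop) (by unfold mink; fun_prop)
    exact h₁.inter h₂
  have hev : ∀ᶠ t : ℝ in 𝓝 0, w + t • x ∈ Vplus := by
    have hcont : Continuous fun t : ℝ ↦ w + t • x := by fun_prop
    exact hcont.continuousAt.eventually_mem (hopen.mem_nhds (by simpa using hw))
  obtain ⟨t, ⟨htw, ht1⟩, ht0⟩ : ∃ t : ℝ, (w + t • x ∈ Vplus ∧ t < 1) ∧ 0 < t := by
    have h := (hev.and (eventually_lt_nhds zero_lt_one)).filter_mono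
      (nhdsWithin_le_nhds (s := Ioi (0 : ℝ)))
    exact (h.and self_mem_nhdsWithin).exists
  have hz : t⁻¹ • (w + t • x) ∈ Vplus := by
    have hs : mink (t⁻¹ • (w + t • x)) (t⁻¹ • (w + t • x))
        = t⁻¹ ^ 2 * mink (w + t • x) (w + t • x) := by
      simp only [mink, Pi.smul_apply, smul_eq_mul]; ring
    refine ⟨?_, ?_⟩
    · have := htw.1
      rw [Pi.smul_apply, smul_eq_mul]
      positivity
    · have := htw.2
      rw [hs]
      positivity
  have hmem := hconv hx (hV hz) (sub_nonneg.2 ht1.le) ht0.le (by ring)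
  convert hmem using 1
  rw [smul_smul, mul_inv_cancel₀ ht0.ne', one_smul, sub_smul, one_smul]
  abel

/-- A function whose derivative along `p` vanishes on a convex open set takes equal values at points
of the set that differ by a multiple of `p`. -/
lemma Convex.eq_of_fderiv_apply_eq_zero {V E : Type*} [NormedAddCommGroup V] [NormedSpace ℝ V]
    [NormedAddCommGroup E] [NormedSpace ℝ E] {O : Set V} (hopen : IsOpen O)
    (hconv : Convex ℝ O) {F : V → E} (hF : DifferentiableOn ℝ F O) {p : V}
    (hp : ∀ x ∈ O, fderiv ℝ F x p = 0) {x : V} {s t : ℝ} (hs : x + s • p ∈ O)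
    (ht : x + t • p ∈ O) : F (x + s • p) = F (x + t • p) := by
  let ℓ : ℝ → V := fun r ↦ x + r • p
  have hpre : Convex ℝ (ℓ ⁻¹' O) := by
    intro r hr r' hr' α β hα hβ hαβ
    have := hconv hr hr' hα hβ hαβ
    rw [mem_preimage]
    convert this using 1
    simp only [ℓ, smul_add, smul_smul, smul_eq_mul, add_smul]
    have : x = α • x + β • x := by rw [← add_smul, hαβ, one_smul]
    nth_rewrite 1 [this]
    abel
  have hder : ∀ r ∈ ℓ ⁻¹' O, HasDerivWithinAt (F ∘ ℓ) 0 (ℓ ⁻¹' O) r := by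
    intro r hr
    have hℓ : HasDerivAt ℓ p r := by
      simpa [ℓ] using ((hasDerivAt_id r).smul_const p).const_add x
    have hFr := (hF.differentiableAt (hopen.mem_nhds hr)).hasFDerivAt
    have := hFr.comp_hasDerivAt r hℓ
    rw [hp _ hr] at this
    exact this.hasDerivWithinAt
  have := hpre.norm_image_sub_le_of_norm_hasDerivWithin_le (C := 0) hder (by simp) ht hs
  simpa [sub_eq_zero] using this

/-- In the directions transverse to `p`, the Laplacian of a solution of the wave equation that is
constant along `p` is minus its d'Alembertian: the algebraic identity between second derivatives. -/
lemma bilin_transverse_trace (B : (Fin 4 → ℝ) →L[ℝ] (Fin 4 → ℝ) →L[ℝ] ℂ)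
    (hsymm : ∀ v w, B v w = B w v) {n u v : Fin 4 → ℝ} (hB : ∀ w, B w n = 0) (hn : n 0 = 1)
    (hu : u 0 = 0) (hv : v 0 = 0)
    (h₁₁ : u 1 * u 1 + v 1 * v 1 = 1 - n 1 * n 1) (h₂₂ : u 2 * u 2 + v 2 * v 2 = 1 - n 2 * n 2)
    (h₃₃ : u 3 * u 3 + v 3 * v 3 = 1 - n 3 * n 3) (h₁₂ : u 1 * u 2 + v 1 * v 2 = -(n 1 * n 2))
    (h₁₃ : u 1 * u 3 + v 1 * v 3 = -(n 1 * n 3)) (h₂₃ : u 2 * u 3 + v 2 * v 3 = -(n 2 * n 3)) :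
    B u u + B v v = -(B (Pi.single 0 1) (Pi.single 0 1) - B (Pi.single 1 1) (Pi.single 1 1)
      - B (Pi.single 2 1) (Pi.single 2 1) - B (Pi.single 3 1) (Pi.single 3 1)) := by
  have hdec (w : Fin 4 → ℝ) : w = w 0 • Pi.single 0 1 + w 1 • Pi.single 1 1
      + w 2 • Pi.single 2 1 + w 3 • Pi.single 3 1 := by
    ext i; fin_cases i <;> simp
  have hBw (w w' : Fin 4 → ℝ) : B w w' = ∑ i, ∑ j, (w i : ℂ) * (w' j : ℂ) *
      B (Pi.single i 1) (Pi.single j 1) := by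
    conv_lhs => rw [hdec w, hdec w']
    simp only [map_add, map_smul, add_apply, smul_apply, Complex.real_smul, Fin.sum_univ_four]
    ring
  have e0 := hB (Pi.single 0 1)
  have en := hB n
  rw [hBw] at e0 en
  rw [hBw u u, hBw v v]
  simp only [Fin.sum_univ_four, hu, hv, hn] at e0 en ⊢
  simp only [hsymm (Pi.single 1 1) (Pi.single 0 1), hsymm (Pi.single 2 1) (Pi.single 0 1),
    hsymm (Pi.single 3 1) (Pi.single 0 1), hsymm (Pi.single 2 1) (Pi.single 1 1),
    hsymm (Pi.single 3 1) (Pi.single 1 1), hsymm (Pi.single 3 1) (Pi.single 2 1)] at e0 en ⊢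
  simp at e0 en ⊢
  generalize B (Pi.single 0 1) (Pi.single 0 1) = b00 at *
  generalize B (Pi.single 0 1) (Pi.single 1 1) = b01 at *
  generalize B (Pi.single 0 1) (Pi.single 2 1) = b02 at *
  generalize B (Pi.single 0 1) (Pi.single 3 1) = b03 at *
  generalize B (Pi.single 1 1) (Pi.single 1 1) = b11 at *
  generalize B (Pi.single 1 1) (Pi.single 2 1) = b12 at *
  generalize B (Pi.single 1 1) (Pi.single 3 1) = b13 at *
  generalize B (Pi.single 2 1) (Pi.single 2 1) = b22 at *
  generalize B (Pi.single 2 1) (Pi.single 3 1) = b23 at *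
  generalize B (Pi.single 3 1) (Pi.single 3 1) = b33 at *
  have c₁₁ := congrArg (fun r : ℝ ↦ (r : ℂ)) h₁₁
  have c₂₂ := congrArg (fun r : ℝ ↦ (r : ℂ)) h₂₂
  have c₃₃ := congrArg (fun r : ℝ ↦ (r : ℂ)) h₃₃
  have c₁₂ := congrArg (fun r : ℝ ↦ (r : ℂ)) h₁₂
  have c₁₃ := congrArg (fun r : ℝ ↦ (r : ℂ)) h₁₃
  have c₂₃ := congrArg (fun r : ℝ ↦ (r : ℂ)) h₂₃
  push_cast at c₁₁ c₂₂ c₃₃ c₁₂ c₁₃ c₂₃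
  linear_combination b11 * c₁₁ + b22 * c₂₂ + b33 * c₃₃ + 2 * b12 * c₁₂ + 2 * b13 * c₁₃
    + 2 * b23 * c₂₃ - en + 2 * e0

/-- The second derivative of `F` precomposed with an affine map. -/
lemma iteratedFDeriv_two_comp_const_add {V W E : Type*} [NormedAddCommGroup V] [NormedSpace ℝ V]
    [NormedAddCommGroup W] [NormedSpace ℝ W] [NormedAddCommGroup E] [NormedSpace ℝ E]
    {F : V → E} {c : V} (L : W →L[ℝ] V) {z : W} (hF : ContDiffAt ℝ 2 F (c + L z)) (w : W) :
    iteratedFDeriv ℝ 2 (fun z ↦ F (c + L z)) z ![w, w]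
      = fderiv ℝ (fderiv ℝ F) (c + L z) (L w) (L w) := by
  have hL (z : W) : HasFDerivAt (fun z ↦ c + L z) L z := L.hasFDerivAt.const_add c
  have hev : fderiv ℝ (fun z ↦ F (c + L z)) =ᶠ[𝓝 z] fun z ↦ (fderiv ℝ F (c + L z)).comp L := by
    have := (hL z).continuousAt.eventually (hF.eventually (by simp))
    filter_upwards [this] with y hy
    exact ((hy.differentiableAt (by simp)).hasFDerivAt.comp y (hL y)).fderiv
  have hd : HasFDerivAt (fderiv ℝ F) (fderiv ℝ (fderiv ℝ F) (c + L z)) (c + L z) :=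
    ((hF.fderiv_right (m := 1) (by norm_num)).differentiableAt (by simp)).hasFDerivAt
  have h2 := (hd.comp z (hL z)).clm_comp (hasFDerivAt_const L z)
  rw [iteratedFDeriv_two_apply, hev.fderiv_eq]
  rw [show fderiv ℝ (fun z ↦ (fderiv ℝ F (c + L z)).comp L) z = _ from h2.fderiv]
  simp

lemma fderiv_fderiv_apply_const {V E : Type*} [NormedAddCommGroup V] [NormedSpace ℝ V]
    [NormedAddCommGroup E] [NormedSpace ℝ E] {F : V → E} {x : V} (hF : ContDiffAt ℝ 2 F x)
    (v w : V) : fderiv ℝ (fun y ↦ fderiv ℝ F y v) x w = fderiv ℝ (fderiv ℝ F) x w v := by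
  have hd : DifferentiableAt ℝ (fderiv ℝ F) x :=
    (hF.fderiv_right (m := 1) (by norm_num)).differentiableAt (by simp)
  rw [fderiv_clm_apply hd (differentiableAt_const v)]
  simp

lemma box_eq_fderiv_fderiv {F : (Fin 4 → ℝ) → ℂ} {x : Fin 4 → ℝ} (hF : ContDiffAt ℝ 2 F x) :
    box F x = fderiv ℝ (fderiv ℝ F) x (Pi.single 0 1) (Pi.single 0 1)
      - fderiv ℝ (fderiv ℝ F) x (Pi.single 1 1) (Pi.single 1 1)
      - fderiv ℝ (fderiv ℝ F) x (Pi.single 2 1) (Pi.single 2 1)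
      - fderiv ℝ (fderiv ℝ F) x (Pi.single 3 1) (Pi.single 3 1) := by
  simp only [box, ← fderiv_fderiv_apply_const hF]
  rfl

lemma sum_mul_pd_eq_fderiv (F : (Fin 4 → ℝ) → ℂ) (x p : Fin 4 → ℝ) :
    ∑ ν : Fin 4, (p ν : ℂ) * pd ν F x = fderiv ℝ F x p := by
  have hp : p = ∑ ν, p ν • Pi.single ν (1 : ℝ) := pi_eq_sum_univ' p
  conv_rhs => rw [hp]
  simp [pd]

/-- Transverse constancy step in the proof of Proposition 5.2: a smooth
function F on an open convex region 𝒪 ⊇ V₊, bounded in modulus by 1, whose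
derivative along the positive lightlike direction p vanishes and which
solves the wave equation, depends only on the Minkowski product p·x. -/
theorem bounded_transported_wave_solution_depends_only_on_px
    (O : Set (Fin 4 → ℝ)) (hOopen : IsOpen O) (hOconv : Convex ℝ O)
    (hOV : Vplus ⊆ O)
    (p : Fin 4 → ℝ) (hp : PosLightlike p)
    (F : (Fin 4 → ℝ) → ℂ) (hF : ContDiffOn ℝ (⊤ : ℕ∞) F O)
    (hFbd : ∀ x ∈ O, ‖F x‖ ≤ 1)
    (hFtrans : ∀ x ∈ O, ∑ ν : Fin 4, (p ν : ℂ) * pd ν F x = 0)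
    (hFwave : ∀ x ∈ O, box F x = 0) :
    ∀ x ∈ O, ∀ y ∈ O, mink p x = mink p y → F x = F y := by
  intro x hx y hy hxy
  obtain ⟨-, hpp, hp0⟩ := hp
  have hC2 (z) (hz : z ∈ O) : ContDiffAt ℝ 2 F z :=
    (hF.contDiffAt (hOopen.mem_nhds hz)).of_le (WithTop.coe_le_coe.2 (le_top : (2 : ℕ∞) ≤ ⊤))
  have hdiff : DifferentiableOn ℝ F O := fun z hz ↦
    ((hC2 z hz).differentiableAt (by simp)).differentiableWithinAt
  -- normalise `p` and choose an orthonormal frame transverse to it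
  obtain ⟨n, hpn, hn0⟩ : ∃ n : Fin 4 → ℝ, p = p 0 • n ∧ n 0 = 1 :=
    ⟨(p 0)⁻¹ • p, by rw [smul_smul, mul_inv_cancel₀ hp0.ne', one_smul], by simp [hp0.ne']⟩
  have hpi (i : Fin 4) : p i = p 0 * n i := congrFun hpn i
  have hn : n 1 ^ 2 + n 2 ^ 2 + n 3 ^ 2 = 1 := by
    have h : p 0 ^ 2 * (1 - (n 1 ^ 2 + n 2 ^ 2 + n 3 ^ 2)) = 0 := by
      rw [← hpp, mink, hpi 1, hpi 2, hpi 3]; ring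
    have := (mul_eq_zero.1 h).resolve_left (by positivity)
    linarith
  have htrans (z) (hz : z ∈ O) : fderiv ℝ F z n = 0 := by
    have h := hFtrans z hz
    rw [sum_mul_pd_eq_fderiv, hpn, map_smul] at h
    exact (smul_eq_zero.1 h).resolve_left hp0.ne'
  obtain ⟨u₁, u₂, u₃, v₁, v₂, v₃, ⟨huu, hvv, huv⟩, ⟨hnu, hnv⟩, ⟨h₁₁, h₂₂, h₃₃⟩, h₁₂, h₁₃, h₂₃⟩ :=
    exists_transverse_frame hn
  let u : Fin 4 → ℝ := ![0, u₁, u₂, u₃]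
  let v : Fin 4 → ℝ := ![0, v₁, v₂, v₃]
  let L : ℂ →L[ℝ] (Fin 4 → ℝ) := Complex.reCLM.smulRight u + Complex.imCLM.smulRight v
  have hL (z : ℂ) : L z = z.re • u + z.im • v := rfl
  have hL0 (z : ℂ) : L z 0 = 0 := by
    simp only [hL, Pi.add_apply, Pi.smul_apply, show u 0 = 0 from rfl, show v 0 = 0 from rfl,
      smul_zero, add_zero]
  have hL1 (z : ℂ) : L z 1 = z.re * u₁ + z.im * v₁ := rfl
  have hL2 (z : ℂ) : L z 2 = z.re * u₂ + z.im * v₂ := rfl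
  have hL3 (z : ℂ) : L z 3 = z.re * u₃ + z.im * v₃ := rfl
  -- transverse planes are reached inside `O` after moving along `p`
  obtain ⟨ε, hε, hxε⟩ : ∃ ε : ℝ, 0 < ε ∧ x - ε • Pi.single 0 1 ∈ O := by
    have hcont : Continuous fun ε : ℝ ↦ x - ε • (Pi.single 0 1 : Fin 4 → ℝ) := by fun_prop
    have hev := (hcont.continuousAt.eventually_mem (x := 0)
      (hOopen.mem_nhds (by simpa using hx))).filter_mono (nhdsWithin_le_nhds (s := Ioi (0 : ℝ)))
    obtain ⟨ε, h, h0⟩ := (hev.and self_mem_nhdsWithin).exists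
    exact ⟨ε, h0, h⟩
  let T : ℂ → ℝ := fun z ↦ (z.re ^ 2 + z.im ^ 2) / (2 * ε)
  have hmem (z : ℂ) : x + L z + T z • n ∈ O := by
    have hT : 2 * ε * T z = z.re ^ 2 + z.im ^ 2 := by simp only [T]; field_simp
    have hT0 : 0 ≤ T z := by positivity
    have hw : ε • Pi.single 0 1 + L z + T z • n ∈ Vplus := by
      refine ⟨?_, ?_⟩
      · simp [hL0, hn0]; positivity
      · have : mink (ε • Pi.single 0 1 + L z + T z • n) (ε • Pi.single 0 1 + L z + T z • n)
            = ε ^ 2 := by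
          simp [mink, hL0, hL1, hL2, hL3, hn0]
          linear_combination hT - z.re ^ 2 * huu - z.im ^ 2 * hvv - 2 * z.re * z.im * huv
            - 2 * T z * z.re * hnu - 2 * T z * z.im * hnv - T z ^ 2 * hn
        rw [this]; positivity
    convert hOconv.add_mem_of_mem_Vplus hOV hxε hw using 1
    abel
  have hslide {z : Fin 4 → ℝ} {s t : ℝ} (hs : z + s • n ∈ O) (ht : z + t • n ∈ O) :
      F (z + s • n) = F (z + t • n) :=
    hOconv.eq_of_fderiv_apply_eq_zero hOopen hdiff htrans hs ht
  let G : ℂ → ℂ := fun z ↦ F (x + L z + T z • n)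
  have hlap (c : Fin 4 → ℝ) (z : ℂ) (hz : c + L z ∈ O) :
      Laplacian.laplacian (fun z ↦ F (c + L z)) z = 0 := by
    have hF2 := hC2 _ hz
    rw [InnerProductSpace.laplacian_eq_iteratedFDeriv_complexPlane]
    simp only [iteratedFDeriv_two_comp_const_add L hF2]
    have hu : L 1 = u := by simp [hL]
    have hv : L Complex.I = v := by simp [hL]
    rw [hu, hv, bilin_transverse_trace _ _ (n := n) _ hn0 rfl rfl h₁₁ h₂₂ h₃₃ h₁₂ h₁₃ h₂₃,
      ← box_eq_fderiv_fderiv hF2, hFwave _ hz, neg_zero]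
    · intro w w'
      exact hF2.isSymmSndFDerivAt (by simp) w w'
    · intro w
      rw [← fderiv_fderiv_apply_const hF2]
      have : (fun y ↦ fderiv ℝ F y n) =ᶠ[𝓝 (c + L z)] fun _ ↦ 0 :=
        Filter.eventually_of_mem (hOopen.mem_nhds hz) htrans
      rw [this.fderiv_eq]
      simp
  have hharm : InnerProductSpace.HarmonicOnNhd G univ := by
    intro z _
    let c := x + T z • n
    have hcont : Continuous fun z ↦ c + L z := by fun_prop
    have hc : ∀ ζ, x + L ζ + T z • n = c + L ζ := fun ζ ↦ by simp only [c]; abel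
    have hz : c + L z ∈ O := by rw [← hc]; exact hmem z
    have hev : ∀ᶠ ζ in 𝓝 z, c + L ζ ∈ O :=
      hcont.continuousAt.eventually_mem (hOopen.mem_nhds hz)
    have hG : G =ᶠ[𝓝 z] fun ζ ↦ F (c + L ζ) := by
      filter_upwards [hev] with ζ hζ
      rw [← hc] at hζ ⊢
      exact hslide (hmem ζ) hζ
    rw [InnerProductSpace.harmonicAt_congr_nhds hG]
    refine ⟨(hC2 _ hz).comp z (by fun_prop), ?_⟩
    filter_upwards [hev] with ζ hζ
    exact hlap c ζ hζ
  have hbdd : Bornology.IsBounded (range G) := by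
    refine isBounded_iff_forall_norm_le.2 ⟨1, ?_⟩
    rintro _ ⟨z, rfl⟩
    exact hFbd _ (hmem z)
  -- decompose `y - x` in the frame
  let z : ℂ := ⟨(y 1 - x 1) * u₁ + (y 2 - x 2) * u₂ + (y 3 - x 3) * u₃,
    (y 1 - x 1) * v₁ + (y 2 - x 2) * v₂ + (y 3 - x 3) * v₃⟩
  have hy0 : y 0 - x 0 = (y 1 - x 1) * n 1 + (y 2 - x 2) * n 2 + (y 3 - x 3) * n 3 := by
    apply mul_left_cancel₀ hp0.ne'
    simp only [mink] at hxy
    rw [hpi 1, hpi 2, hpi 3] at hxy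
    linear_combination -hxy
  have hyz : x + L z + (y 0 - x 0) • n = y := by
    ext i
    fin_cases i
    · simp [hL0, hn0]
    · simp [hL1, z]
      linear_combination n 1 * hy0 + (y 1 - x 1) * h₁₁ + (y 2 - x 2) * h₁₂ + (y 3 - x 3) * h₁₃
    · simp [hL2, z]
      linear_combination n 2 * hy0 + (y 1 - x 1) * h₁₂ + (y 2 - x 2) * h₂₂ + (y 3 - x 3) * h₂₃
    · simp [hL3, z]
      linear_combination n 3 * hy0 + (y 1 - x 1) * h₁₃ + (y 2 - x 2) * h₂₃ + (y 3 - x 3) * h₃₃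
  calc F x = G 0 := by simp [G, T]
    _ = G z := InnerProductSpace.bounded_harmonic_on_complex_plane_is_constant G hharm hbdd 0 z
    _ = F (x + L z + (y 0 - x 0) • n) := hslide (hmem z) (by rwa [hyz])
    _ = F y := by rw [hyz]
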